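/- Consider an N-player finite-horizon game with horizon T ≥ 1, state dimension n_x and input dimension n_u. For t ∈ {0,…,T−1} let A_t ∈ ℝ^{n_x×n_x}, B_t^j ∈ ℝ^{n_x×n_u}, K_t^j ∈ ℝ^{n_u×n_x}, α_t^j ∈ ℝ^{n_u} (j = 1,…,N), and for each player i let Q_t^i ∈ ℝ^{n_x×n_x}, l_t^i ∈ ℝ^{n_x} (t = 1,…,T), R_t^i ∈ ℝ^{n_u×n_u} (t = 0,…,T−1), and P_t^i ∈ ℝ^{n_x×n_x}, ζ_t^i ∈ ℝ^{n_x} (t = 0,…,T). Let F_t = A_t − Σ_{j=1}^N B_t^j K_t^j, and assume F_t is invertible for every t ∈ {0,…,T−1}. Assume the terminal conditions P_T^i = Q_T^i and ζ_T^i = l_T^i, and that for every t ∈ {0,…,T−1} and every i the coupled Riccati equations hold: (R_t^i + B_t^{i⊤} P_{t+1}^i B_t^i) K_t^i = B_t^{i⊤} P_{t+1}^i (A_t − Σ_{j≠i} B_t^j K_t^j); (R_t^i + B_t^{i⊤} P_{t+1}^i B_t^i) α_t^i = B_t^{i⊤} (ζ_{t+1}^i − P_{t+1}^i Σ_{j≠i}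 B_t^j α_t^j); P_t^i = F_t^⊤ P_{t+1}^i F_t + K_t^{i⊤} R_t^i K_t^i + Q_t^i and ζ_t^i = F_t^⊤ (ζ_{t+1}^i − P_{t+1}^i Σ_{j=1}^N B_t^j α_t^j) + K_t^{i⊤} R_t^i α_t^i + l_t^i (the last two for t = 1,…,T−1). Define E_t^i = K_t^i F_t^{−1} Σ_{j=1}^N B_t^j α_t^j + α_t^i, and for t = 1,…,T−1 define Δ_t^i = F_t^⊤ P_{t+1}^i F_t + K_t^{i⊤} R_t^i K_t^i and Ω_t^i = F_t^⊤ (ζ_{t+1}^i − P_{t+1}^i Σ_{j=1}^N B_t^j α_t^j) + K_t^{i⊤} R_t^i α_t^i, with Δ_T^i = 0 and Ω_T^i = 0. Then for every t ∈ {1,…,T} and every player i: B_{t−1}^{i⊤} Q_t^i F_{t−1} + B_{t−1}^{i⊤} Δ_t^i F_{t−1} − R_{t−1}^i K_{t−1}^i = 0 and B_{t−1}^{i⊤} Ω_t^i + B_{t−1}^{i⊤} l_t^i − R_{t−1}^i E_{t−1}^i = 0. -/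

import Mathlib

open Matrix

/-- A gain solving the Riccati equation of player `i` satisfies `R Kᵢ = Bᵢᵀ P F` for the closed-loop
matrix `F = A − Σⱼ Bⱼ Kⱼ`. -/
theorem riccati_gain_eq {ι m n : Type*} [Fintype ι] [DecidableEq ι] [Fintype m] [Fintype n]
    (A P : Matrix n n ℝ) (R : Matrix m m ℝ) (B : ι → Matrix n m ℝ) (K : ι → Matrix m n ℝ) (i : ι)
    (h : (R + (B i)ᵀ * P * B i) * K i
      = (B i)ᵀ * P * (A - ∑ j ∈ Finset.univ.erase i, B j * K j)) :
    R * K i = (B i)ᵀ * P * (A - ∑ j, B j * K j) := by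
  rw [← Finset.add_sum_erase _ _ (Finset.mem_univ i), sub_add_eq_sub_sub_swap, Matrix.mul_sub, ← h,
    Matrix.add_mul, ← Matrix.mul_assoc, add_sub_cancel_right]

/-- An offset solving the Riccati equation of player `i` satisfies
`R αᵢ = Bᵢᵀ ζ − Bᵢᵀ P (Σⱼ Bⱼ αⱼ)`. -/
theorem riccati_offset_eq {ι m n : Type*} [Fintype ι] [DecidableEq ι] [Fintype m] [Fintype n]
    (P : Matrix n n ℝ) (R : Matrix m m ℝ) (B : ι → Matrix n m ℝ) (α : ι → m → ℝ) (ζ : n → ℝ)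
    (i : ι)
    (h : (R + (B i)ᵀ * P * B i) *ᵥ α i
      = (B i)ᵀ *ᵥ (ζ - P *ᵥ (∑ j ∈ Finset.univ.erase i, B j *ᵥ α j))) :
    R *ᵥ α i = (B i)ᵀ *ᵥ ζ - ((B i)ᵀ * P) *ᵥ (∑ j, B j *ᵥ α j) := by
  rw [Matrix.add_mulVec, Matrix.mulVec_sub, Matrix.mulVec_mulVec] at h
  rw [← Finset.add_sum_erase _ _ (Finset.mem_univ i), Matrix.mulVec_add, Matrix.mulVec_mulVec,
    sub_add_eq_sub_sub_swap, ← h, add_sub_cancel_right]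

/-- Characterization of the cost parameters generating a given feedback Nash
equilibrium of a finite-horizon linear quadratic game: given the coupled
backward Riccati recursions, for every `t ∈ {1,…,T}` and every player `i`,
`B_{t−1}ⁱᵀ Qₜⁱ F_{t−1} + B_{t−1}ⁱᵀ Δₜⁱ F_{t−1} − R_{t−1}ⁱ K_{t−1}ⁱ = 0` and
`B_{t−1}ⁱᵀ Ωₜⁱ + B_{t−1}ⁱᵀ lₜⁱ − R_{t−1}ⁱ E_{t−1}ⁱ = 0`. -/
theorem cost_characterization (T N nx nu : ℕ) (hT : 1 ≤ T)
    (A : ℕ → Matrix (Fin nx) (Fin nx) ℝ)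
    (B : ℕ → Fin N → Matrix (Fin nx) (Fin nu) ℝ)
    (K : ℕ → Fin N → Matrix (Fin nu) (Fin nx) ℝ)
    (α : ℕ → Fin N → Fin nu → ℝ)
    (Q : ℕ → Fin N → Matrix (Fin nx) (Fin nx) ℝ)
    (l : ℕ → Fin N → Fin nx → ℝ)
    (R : ℕ → Fin N → Matrix (Fin nu) (Fin nu) ℝ)
    (P : ℕ → Fin N → Matrix (Fin nx) (Fin nx) ℝ)
    (ζ : ℕ → Fin N → Fin nx → ℝ)
    -- closed-loop matrices `F_t = A_t − Σⱼ B_tʲ K_tʲ`, assumed invertible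
    (F : ℕ → Matrix (Fin nx) (Fin nx) ℝ)
    (hF : ∀ t < T, F t = A t - ∑ j, B t j * K t j)
    (hFinv : ∀ t < T, IsUnit (F t))
    -- terminal conditions
    (hPT : ∀ i, P T i = Q T i)
    (hζT : ∀ i, ζ T i = l T i)
    -- coupled Riccati equations for the feedback gains and offsets
    (hK : ∀ t < T, ∀ i,
      (R t i + (B t i)ᵀ * P (t + 1) i * B t i) * K t i
        = (B t i)ᵀ * P (t + 1) i * (A t - ∑ j ∈ Finset.univ.erase i, B t j * K t j))
    (hα : ∀ t < T, ∀ i,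
      (R t i + (B t i)ᵀ * P (t + 1) i * B t i).mulVec (α t i)
        = (B t i)ᵀ.mulVec
            (ζ (t + 1) i
              - (P (t + 1) i).mulVec (∑ j ∈ Finset.univ.erase i, (B t j).mulVec (α t j))))
    -- backward recursions for the value function parameters
    (hP : ∀ t, 1 ≤ t → t ≤ T - 1 → ∀ i,
      P t i = (F t)ᵀ * P (t + 1) i * F t + (K t i)ᵀ * R t i * K t i + Q t i)
    (hζ : ∀ t, 1 ≤ t → t ≤ T - 1 → ∀ i,
      ζ t i = (F t)ᵀ.mulVec
            (ζ (t + 1) i - (P (t + 1) i).mulVec (∑ j, (B t j).mulVec (α t j)))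
          + ((K t i)ᵀ * R t i).mulVec (α t i) + l t i)
    -- the quantities `E`, `Δ`, `Ω`
    (E : ℕ → Fin N → Fin nu → ℝ)
    (hE : ∀ t < T, ∀ i,
      E t i = (K t i * (F t)⁻¹).mulVec (∑ j, (B t j).mulVec (α t j)) + α t i)
    (Δ : ℕ → Fin N → Matrix (Fin nx) (Fin nx) ℝ)
    (Ω : ℕ → Fin N → Fin nx → ℝ)
    (hΔ : ∀ t, 1 ≤ t → t ≤ T - 1 → ∀ i,
      Δ t i = (F t)ᵀ * P (t + 1) i * F t + (K t i)ᵀ * R t i * K t i)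
    (hΩ : ∀ t, 1 ≤ t → t ≤ T - 1 → ∀ i,
      Ω t i = (F t)ᵀ.mulVec
            (ζ (t + 1) i - (P (t + 1) i).mulVec (∑ j, (B t j).mulVec (α t j)))
          + ((K t i)ᵀ * R t i).mulVec (α t i))
    (hΔT : ∀ i, Δ T i = 0)
    (hΩT : ∀ i, Ω T i = 0) :
    ∀ t, 1 ≤ t → t ≤ T → ∀ i,
      (B (t - 1) i)ᵀ * Q t i * F (t - 1) + (B (t - 1) i)ᵀ * Δ t i * F (t - 1)
          - R (t - 1) i * K (t - 1) i = 0 ∧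
      (B (t - 1) i)ᵀ.mulVec (Ω t i) + (B (t - 1) i)ᵀ.mulVec (l t i)
          - (R (t - 1) i).mulVec (E (t - 1) i) = 0 := by
  intro t ht1 htT i
  obtain ⟨s, rfl⟩ : ∃ s, t = s + 1 := ⟨t - 1, by omega⟩
  have hs : s < T := by omega
  simp only [Nat.add_sub_cancel]
  have hPQ : P (s + 1) i = Q (s + 1) i + Δ (s + 1) i := by
    rcases Nat.lt_or_ge (s + 1) T with h | h
    · rw [hP _ ht1 (by omega), hΔ _ ht1 (by omega), add_comm]
    · rw [show s + 1 = T by omega, hPT, hΔT, add_zero]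
  have hζl : ζ (s + 1) i = Ω (s + 1) i + l (s + 1) i := by
    rcases Nat.lt_or_ge (s + 1) T with h | h
    · rw [hζ _ ht1 (by omega), hΩ _ ht1 (by omega)]
    · rw [show s + 1 = T by omega, hζT, hΩT, zero_add]
  have hRK : R s i * K s i = (B s i)ᵀ * P (s + 1) i * F s := by
    rw [hF s hs]
    exact riccati_gain_eq _ _ _ _ _ i (hK s hs i)
  have hRα := riccati_offset_eq _ _ _ _ _ i (hα s hs i)
  have hdet : IsUnit (F s).det := (Matrix.isUnit_iff_isUnit_det _).mp (hFinv s hs)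
  constructor
  · rw [hRK, hPQ, Matrix.mul_add, Matrix.add_mul, sub_self]
  · rw [hE s hs, Matrix.mulVec_add, hRα, Matrix.mulVec_mulVec, ← Matrix.mul_assoc, hRK,
      Matrix.mul_nonsing_inv_cancel_right _ _ hdet, add_sub_cancel, ← Matrix.mulVec_add, ← hζl,
      sub_self]
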